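/- Let (V, ω) be a VOA of CFT type and let a ∈ V_2 ∩ CV. Then there exists h ∈ V_1 such that a = ω + Th. -/

import Mathlib

/-!
Common framework: vertex algebras, ℤ-graded (conformal) vertex algebras,
conformal vectors, automorphism groups, following Moriwaki,
"On classification of conformal vectors in vertex operator algebra and
the vertex algebra automorphism group".
-/

noncomputable section

open scoped BigOperators

/-- The generalized binomial coefficient `binom(m, i)` for `m : ℤ`, valued in a field `K`. -/
def zBinom (K : Type*) [Field K] (m : ℤ) (i : ℕ) : K :=
  (∏ j ∈ Finset.range i, ((m : K) - (j : K))) / (Nat.factorial i : K)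

/-- A vertex algebra over a field `K`: a `K`-vector space `V` equipped with bilinear
`n`-th products `a(n)b` (`n : ℤ`) and a vacuum vector `𝟙`, subject to the truncation
condition, the vacuum and creation axioms, and the Borcherds identity. -/
structure VA (K V : Type*) [Field K] [AddCommGroup V] [Module K V] where
  /-- the `n`-th product `a(n)b`, bilinear in `a` and `b` -/
  ncoef : ℤ → V →ₗ[K] V →ₗ[K] V
  /-- the vacuum vector `𝟙` -/
  vac : V
  /-- truncation: `a(n)b = 0` for `n` sufficiently large -/
  trunc : ∀ a b : V, ∃ N : ℤ, ∀ n : ℤ, N ≤ n → ncoef n a b = 0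
  /-- the vacuum axiom `Y(𝟙, z) = id`, i.e. `𝟙(n)a = δ_{n,-1} a` -/
  vac_ncoef : ∀ (n : ℤ) (a : V), ncoef n vac a = if n = -1 then a else 0
  /-- creation: `a(-1)𝟙 = a` -/
  ncoef_vac : ∀ a : V, ncoef (-1) a vac = a
  /-- creation: `a(n)𝟙 = 0` for `n ≥ 0` -/
  ncoef_vac_zero : ∀ n : ℤ, 0 ≤ n → ∀ a : V, ncoef n a vac = 0
  /-- the Borcherds identity -/
  borcherds : ∀ (a b c : V) (p q m : ℤ),
    (∑ᶠ i : ℕ, zBinom K m i •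
        ncoef (m + q - (i : ℤ)) (ncoef (p + (i : ℤ)) a b) c)
      = ∑ᶠ i : ℕ, ((-1 : K) ^ i * zBinom K p i) •
          (ncoef (m + p - (i : ℤ)) a (ncoef (q + (i : ℤ)) b c)
            - ((p.negOnePow : ℤ) : K) •
                ncoef (p + q - (i : ℤ)) b (ncoef (m + (i : ℤ)) a c))

namespace VA

variable {K V : Type*} [Field K] [AddCommGroup V] [Module K V]

/-- The translation operator `T a = a(-2)𝟙`. -/
def T (A : VA K V) : V →ₗ[K] V := (A.ncoef (-2)).flip A.vac

/-- The eigenspace `V_n^a = {v ∈ V | a(1)v = n v}` of `a(1)`. -/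
def eig (A : VA K V) (a : V) (n : ℤ) : Submodule K V :=
  LinearMap.ker (A.ncoef 1 a - (n : K) • (LinearMap.id : V →ₗ[K] V))

/-- `a` is a conformal vector: `a(1)a = 2a`, `a(3)a ∈ K𝟙`, `a(2)a = 0`, `a(n)a = 0`
for `n ≥ 4`, `a(0) = T`, and `a(1)` is semisimple with integer eigenvalues
(`V = ⊕_{n ∈ ℤ} V_n^a`). -/
def IsConformal (A : VA K V) (a : V) : Prop :=
  A.ncoef 1 a a = (2 : K) • a ∧
  (∃ c : K, A.ncoef 3 a a = c • A.vac) ∧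
  A.ncoef 2 a a = 0 ∧
  (∀ n : ℤ, 4 ≤ n → A.ncoef n a a = 0) ∧
  A.ncoef 0 a = A.T ∧
  DirectSum.IsInternal (A.eig a)

/-- `a` is a conformal vector of CFT type: `(V, a)` is a VOA of CFT type, i.e.
`V = ⊕_{n ∈ ℕ} V_n^a` with finite-dimensional pieces and `V_0^a = K𝟙`. -/
def IsConformalCFT (A : VA K V) (a : V) : Prop :=
  A.IsConformal a ∧
  (∀ n : ℤ, n < 0 → A.eig a n = ⊥) ∧
  (∀ n : ℤ, FiniteDimensional K (A.eig a n)) ∧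
  A.eig a 0 = Submodule.span K {A.vac}

/-- `a` is a conformal vector of strong CFT type: of CFT type and `a(2)V_1^a = 0`
(i.e. `L^a(1) V_1^a = 0`). -/
def IsConformalSCFT (A : VA K V) (a : V) : Prop :=
  A.IsConformalCFT a ∧ ∀ v ∈ A.eig a 1, A.ncoef 2 a v = 0

/-- A vertex algebra homomorphism: a linear map preserving all products and the vacuum. -/
structure IsVAHom (A : VA K V) (f : V → V) : Prop where
  map_add : ∀ a b : V, f (a + b) = f a + f b
  map_smul : ∀ (c : K) (a : V), f (c • a) = c • f a
  map_ncoef : ∀ (n : ℤ) (a b : V), f (A.ncoef n a b) = A.ncoef n (f a) (f b)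
  map_vac : f A.vac = A.vac

/-- A vertex algebra automorphism: a bijective vertex algebra homomorphism. -/
def IsVAAut (A : VA K V) (f : V → V) : Prop :=
  A.IsVAHom f ∧ Function.Bijective f

/-- A (two-sided) ideal of a vertex algebra. -/
def IsIdeal (A : VA K V) (I : Submodule K V) : Prop :=
  ∀ (n : ℤ) (a : V), ∀ b ∈ I, A.ncoef n a b ∈ I ∧ A.ncoef n b a ∈ I

/-- A vertex algebra is simple if it has no ideals other than `0` and itself. -/
def IsSimple (A : VA K V) : Prop :=
  ∀ I : Submodule K V, A.IsIdeal I → I = ⊥ ∨ I = ⊤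

end VA

/-- The exponential `exp f = Σ_{n≥0} f^n / n!` of an endomorphism, as a function
(meaningful for locally nilpotent `f`). -/
def expOp {K V : Type*} [Field K] [AddCommGroup V] [Module K V]
    (f : V →ₗ[K] V) (v : V) : V :=
  ∑ᶠ n : ℕ, (Nat.factorial n : K)⁻¹ • (f ^ n) v

/-- A ℤ-grading on a vertex algebra, making it a ℤ-graded vertex algebra:
`V = ⊕_{n ∈ ℤ} V_n`, `V_n(k)V_m ⊆ V_{n+m-k-1}` and `𝟙 ∈ V_0`. -/
structure GradedVA {K V : Type*} [Field K] [AddCommGroup V] [Module K V] (A : VA K V) where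
  /-- the grading subspaces `V_n` -/
  gr : ℤ → Submodule K V
  /-- `V = ⊕_{n ∈ ℤ} V_n` -/
  decomp : DirectSum.Decomposition gr
  /-- `𝟙 ∈ V_0` -/
  vac_mem : A.vac ∈ gr 0
  /-- `V_n(k)V_m ⊆ V_{n+m-k-1}` -/
  ncoef_mem : ∀ (n m k : ℤ), ∀ a ∈ gr n, ∀ b ∈ gr m, A.ncoef k a b ∈ gr (n + m - k - 1)

namespace GradedVA

variable {K V : Type*} [Field K] [AddCommGroup V] [Module K V] {A : VA K V}

/-- The canonical projection `pr_n : V → V_n`. -/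
def pr (G : GradedVA A) (n : ℤ) (v : V) : V :=
  letI := G.decomp
  (DirectSum.decompose G.gr v n : V)

/-- `V_{≥n} = ⊕_{i ≥ n} V_i`. -/
def ge (G : GradedVA A) (n : ℤ) : Submodule K V := ⨆ i ≥ n, G.gr i

/-- `V_{≤n} = ⊕_{i ≤ n} V_i`. -/
def le (G : GradedVA A) (n : ℤ) : Submodule K V := ⨆ i ≤ n, G.gr i

/-- `J_1(V) = {a ∈ V_1 | a(0) = 0}`. -/
def J1 (G : GradedVA A) : Set V :=
  {a : V | a ∈ G.gr 1 ∧ A.ncoef 0 a = 0}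

/-- `Aut⁺V`: automorphisms `f` with `f(V_n) ⊆ V_{≥n}` and `pr_n ∘ f|_{V_n} = id`. -/
def AutPlus (G : GradedVA A) (f : V → V) : Prop :=
  A.IsVAAut f ∧ ∀ n : ℤ, ∀ v ∈ G.gr n, f v ∈ G.ge n ∧ G.pr n (f v) = v

/-- `Aut⁻V`: automorphisms `f` with `f(V_n) ⊆ ⊕_{k ≤ n} V_k` and `pr_n ∘ f|_{V_n} = id`. -/
def AutMinus (G : GradedVA A) (f : V → V) : Prop :=
  A.IsVAAut f ∧ ∀ n : ℤ, ∀ v ∈ G.gr n, f v ∈ G.le n ∧ G.pr n (f v) = v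

/-- `Aut⁰V`: automorphisms `f` with `f(V_n) ⊆ V_n`. -/
def AutZero (G : GradedVA A) (f : V → V) : Prop :=
  A.IsVAAut f ∧ ∀ n : ℤ, ∀ v ∈ G.gr n, f v ∈ G.gr n

end GradedVA

/-- A ℤ-graded conformal vertex algebra: a ℤ-graded vertex algebra with a conformal
vector `ω ∈ V_2` whose modes `L(n) = ω(n+1)` satisfy the Virasoro relations, with
`L(0)v = n v` for `v ∈ V_n` and `L(-1) = T`. -/
structure ConfGVA {K V : Type*} [Field K] [AddCommGroup V] [Module K V] (A : VA K V)
    extends GradedVA A where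
  /-- the conformal vector -/
  ω : V
  ω_mem : ω ∈ gr 2
  /-- the Virasoro relations `[L(n), L(m)] = (n-m)L(n+m) + δ_{n+m,0}((n³-n)/12)c` -/
  virasoro : ∃ c : K, ∀ n m : ℤ,
    A.ncoef (n + 1) ω ∘ₗ A.ncoef (m + 1) ω - A.ncoef (m + 1) ω ∘ₗ A.ncoef (n + 1) ω
      = ((n : K) - (m : K)) • A.ncoef (n + m + 1) ω
        + (if n + m = 0 then ((n : K) ^ 3 - (n : K)) / 12 * c else 0)
            • (LinearMap.id : V →ₗ[K] V)
  /-- `L(0) v = n v` for `v ∈ V_n` -/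
  L0_grading : ∀ n : ℤ, ∀ v ∈ gr n, A.ncoef 1 ω v = (n : K) • v
  /-- `L(-1) = T` -/
  Lneg1_eq_T : A.ncoef 0 ω = A.T

namespace ConfGVA

variable {K V : Type*} [Field K] [AddCommGroup V] [Module K V] {A : VA K V}

abbrev pr (C : ConfGVA A) : ℤ → V → V := C.toGradedVA.pr
abbrev ge (C : ConfGVA A) : ℤ → Submodule K V := C.toGradedVA.ge
abbrev le (C : ConfGVA A) : ℤ → Submodule K V := C.toGradedVA.le
abbrev J1 (C : ConfGVA A) : Set V := C.toGradedVA.J1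
abbrev AutPlus (C : ConfGVA A) : (V → V) → Prop := C.toGradedVA.AutPlus
abbrev AutMinus (C : ConfGVA A) : (V → V) → Prop := C.toGradedVA.AutMinus
abbrev AutZero (C : ConfGVA A) : (V → V) → Prop := C.toGradedVA.AutZero

/-- `Aut_ω V`: the VOA automorphisms, i.e. the stabilizer of `ω` in `Aut V`. -/
def AutOmega (C : ConfGVA A) (f : V → V) : Prop :=
  A.IsVAAut f ∧ f C.ω = C.ω

/-- An invariant bilinear form on `(V, ω)`:
`(a(n)b, c) = (-1)^d Σ_{j≥0} (1/j!) (b, (L(1)^j a)(2d-n-2-j) c)` for `a ∈ V_d`, which is the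
coefficient form of `(Y(a,z)b, c) = (b, Y(e^{zL(1)}(-z^{-2})^{L(0)} a, z^{-1}) c)`. -/
def IsInvForm (C : ConfGVA A) (B : V →ₗ[K] V →ₗ[K] K) : Prop :=
  ∀ d : ℤ, ∀ a ∈ C.gr d, ∀ (b c : V) (n : ℤ),
    B (A.ncoef n a b) c
      = ((d.negOnePow : ℤ) : K) *
          ∑ᶠ j : ℕ, (Nat.factorial j : K)⁻¹ *
            B b (A.ncoef (2 * d - n - 2 - (j : ℤ)) ((A.ncoef 2 C.ω ^ j) a) c)

end ConfGVA

/-- A VOA of CFT type: a ℤ-graded conformal vertex algebra with `V = ⊕_{n ∈ ℕ} V_n`,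
`dim V_n < ∞`, and `V_0 = K𝟙`. -/
structure VOACFT {K V : Type*} [Field K] [AddCommGroup V] [Module K V] (A : VA K V)
    extends ConfGVA A where
  gr_neg : ∀ n : ℤ, n < 0 → gr n = ⊥
  gr_fd : ∀ n : ℤ, FiniteDimensional K (gr n)
  gr_zero : gr 0 = Submodule.span K {A.vac}

namespace VOACFT

variable {K V : Type*} [Field K] [AddCommGroup V] [Module K V] {A : VA K V}

abbrev pr (W : VOACFT A) : ℤ → V → V := W.toConfGVA.pr
abbrev ge (W : VOACFT A) : ℤ → Submodule K V := W.toConfGVA.ge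
abbrev le (W : VOACFT A) : ℤ → Submodule K V := W.toConfGVA.le
abbrev J1 (W : VOACFT A) : Set V := W.toConfGVA.J1
abbrev AutPlus (W : VOACFT A) : (V → V) → Prop := W.toConfGVA.AutPlus
abbrev AutMinus (W : VOACFT A) : (V → V) → Prop := W.toConfGVA.AutMinus
abbrev AutZero (W : VOACFT A) : (V → V) → Prop := W.toConfGVA.AutZero
abbrev AutOmega (W : VOACFT A) : (V → V) → Prop := W.toConfGVA.AutOmega
abbrev IsInvForm (W : VOACFT A) : (V →ₗ[K] V →ₗ[K] K) → Prop := W.toConfGVA.IsInvForm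

end VOACFT

/-- A VOA of strong CFT type: a VOA of CFT type with `L(1)V_1 = 0`. -/
structure VOAsCFT {K V : Type*} [Field K] [AddCommGroup V] [Module K V] (A : VA K V)
    extends VOACFT A where
  L1_V1 : ∀ v ∈ gr 1, A.ncoef 2 ω v = 0

namespace VOAsCFT

variable {K V : Type*} [Field K] [AddCommGroup V] [Module K V] {A : VA K V}

abbrev pr (W : VOAsCFT A) : ℤ → V → V := W.toVOACFT.pr
abbrev ge (W : VOAsCFT A) : ℤ → Submodule K V := W.toVOACFT.ge
abbrev le (W : VOAsCFT A) : ℤ → Submodule K V := W.toVOACFT.le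
abbrev J1 (W : VOAsCFT A) : Set V := W.toVOACFT.J1
abbrev AutPlus (W : VOAsCFT A) : (V → V) → Prop := W.toVOACFT.AutPlus
abbrev AutMinus (W : VOAsCFT A) : (V → V) → Prop := W.toVOACFT.AutMinus
abbrev AutZero (W : VOAsCFT A) : (V → V) → Prop := W.toVOACFT.AutZero
abbrev AutOmega (W : VOAsCFT A) : (V → V) → Prop := W.toVOACFT.AutOmega
abbrev IsInvForm (W : VOAsCFT A) : (V →ₗ[K] V →ₗ[K] K) → Prop := W.toVOACFT.IsInvForm

end VOAsCFT

end

section Binomial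

variable (K : Type*) [Field K]

theorem zBinom_zero_right (m : ℤ) : zBinom K m 0 = 1 := by simp [zBinom]

theorem zBinom_one_right (m : ℤ) : zBinom K m 1 = m := by simp [zBinom]

theorem zBinom_zero_left {i : ℕ} (hi : i ≠ 0) : zBinom K 0 i = 0 := by
  rw [zBinom, Finset.prod_eq_zero (Finset.mem_range.mpr (Nat.pos_of_ne_zero hi)) (by simp),
    zero_div]

theorem zBinom_neg_one_two [CharZero K] : zBinom K (-1) 2 = 1 := by
  norm_num [zBinom, Finset.prod_range_succ]

end Binomial

namespace VA

variable {K V : Type*} [Field K] [AddCommGroup V] [Module K V] (A : VA K V)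

theorem T_apply (u : V) : A.T u = A.ncoef (-2) u A.vac := rfl

theorem T_vac : A.T A.vac = 0 := by simp [T_apply, A.vac_ncoef]

/-- `T² u = 2 u(-3)𝟙`. -/
theorem T_T_eq (u : V) : A.T (A.T u) = (2 : K) • A.ncoef (-3) u A.vac := by
  have h := A.borcherds u A.vac A.vac (-2) (-2) 0
  rw [finsum_eq_single _ 0 (fun i hi => by rw [zBinom_zero_left K hi, zero_smul]),
    finsum_eq_single _ 1 (fun i hi => ?_)] at h
  · simpa [zBinom_zero_right, zBinom_one_right, T_apply, A.vac_ncoef, A.ncoef_vac_zero] using h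
  · rw [A.ncoef_vac_zero (0 + (i : ℤ)) (by omega), A.vac_ncoef,
      if_neg (by omega : ¬ (-2 + (i : ℤ) = -1))]
    simp

/-- If `b(0) = 0`, the commutator formula for `[a(-1), b(0)]` applied to the vacuum. -/
theorem finsum_ncoef_vac_eq_zero {b : V} (hb : A.ncoef 0 b = 0) (a : V) :
    ∑ᶠ i : ℕ, zBinom K (-1) i • A.ncoef (-1 - (i : ℤ)) (A.ncoef i a b) A.vac = 0 := by
  have h := A.borcherds a b A.vac 0 0 (-1)
  rw [finsum_eq_single (fun i : ℕ => ((-1 : K) ^ i * zBinom K 0 i) • _) 0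
    (fun i hi => by rw [zBinom_zero_left K hi, mul_zero, zero_smul])] at h
  simpa [hb] using h

end VA

namespace VOACFT

variable {K V : Type*} [Field K] [AddCommGroup V] [Module K V] {A : VA K V} (W : VOACFT A)

theorem ω_ncoef_mem {n : ℤ} {v : V} (hv : v ∈ W.gr n) (k : ℤ) :
    A.ncoef k W.ω v ∈ W.gr (n + 1 - k) := by
  have h := W.ncoef_mem 2 n k _ W.ω_mem v hv
  rwa [show 2 + n - k - 1 = n + 1 - k by ring] at h

theorem T_mem {n : ℤ} {v : V} (hv : v ∈ W.gr n) : A.T v ∈ W.gr (n + 1) := by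
  have h := W.ω_ncoef_mem hv 0
  rwa [W.Lneg1_eq_T, sub_zero] at h

theorem T_eq_zero_of_mem_gr_zero {v : V} (hv : v ∈ W.gr 0) : A.T v = 0 := by
  rw [W.gr_zero, Submodule.mem_span_singleton] at hv
  obtain ⟨c, rfl⟩ := hv
  rw [map_smul, A.T_vac, smul_zero]

/-- The relation `[L(1), L(-1)] = 2 L(0)` on homogeneous vectors. -/
theorem L_one_T {n : ℤ} {v : V} (hv : v ∈ W.gr n) :
    A.ncoef 2 W.ω (A.T v) = A.T (A.ncoef 2 W.ω v) + (2 * n : K) • v := by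
  obtain ⟨c, hc⟩ := W.virasoro
  have h := LinearMap.congr_fun (hc 1 (-1)) v
  norm_num [W.Lneg1_eq_T, W.L0_grading n v hv] at h
  rw [sub_eq_iff_eq_add'] at h
  rw [h, mul_smul]

theorem eq_zero_of_T_eq_zero [CharZero K] {v : V} (hv : v ∈ W.gr 2) (hT : A.T v = 0) :
    v = 0 := by
  have hu : A.ncoef 2 W.ω v ∈ W.gr 1 := by simpa using W.ω_ncoef_mem hv 2
  have hw : A.ncoef 2 W.ω (A.ncoef 2 W.ω v) ∈ W.gr 0 := by simpa using W.ω_ncoef_mem hu 2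
  have h1 := W.L_one_T hv
  have h2 := W.L_one_T hu
  rw [hT, map_zero] at h1
  rw [W.T_eq_zero_of_mem_gr_zero hw] at h2
  have h3 := congrArg (A.ncoef 2 W.ω) h1
  rw [map_zero, map_add, h2, map_smul, zero_add, ← add_smul, eq_comm, smul_eq_zero] at h3
  have hu0 : A.ncoef 2 W.ω v = 0 := h3.resolve_left (by norm_num)
  rw [hu0, map_zero, zero_add, eq_comm, smul_eq_zero] at h1
  exact h1.resolve_left (by norm_num)

/-- If `b ∈ V_2` and `b(0) = 0`, then `T b = T² (L(1) b / 2)`. -/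
theorem T_eq_T_T_of_ncoef_zero [CharZero K] {b : V} (hb : b ∈ W.gr 2) (h0 : A.ncoef 0 b = 0) :
    A.T b = A.T (A.T ((2 : K)⁻¹ • A.ncoef 2 W.ω b)) := by
  have h := A.finsum_ncoef_vac_eq_zero h0 W.ω
  have hvanish (i : ℕ) (hi : 3 ≤ i) :
      A.ncoef (-1 - (i : ℤ)) (A.ncoef i W.ω b) A.vac = 0 := by
    have hmem := W.ω_ncoef_mem hb i
    obtain rfl | hi := hi.eq_or_lt
    · rw [show (2 + 1 - ((3 : ℕ) : ℤ)) = 0 by norm_num, W.gr_zero,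
        Submodule.mem_span_singleton] at hmem
      obtain ⟨c, hc⟩ := hmem
      rw [← hc, map_smul, LinearMap.smul_apply, A.vac_ncoef, if_neg (by norm_num), smul_zero]
    · rw [W.gr_neg _ (by omega), Submodule.mem_bot] at hmem
      rw [hmem, map_zero, LinearMap.zero_apply]
  rw [finsum_eq_sum_of_support_subset (s := Finset.range 3) _ (fun i hi => by
    by_contra hn
    exact hi (by simp only [hvanish i (by simpa using hn), smul_zero]))] at h
  have hL0 : A.ncoef 1 W.ω b = (2 : K) • b := by simpa using W.L0_grading 2 b hb
  simp only [Finset.sum_range_succ, Finset.sum_range_zero, zBinom_zero_right, zBinom_one_right,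
    zBinom_neg_one_two] at h
  norm_num [W.Lneg1_eq_T, hL0, A.ncoef_vac, ← A.T_apply] at h
  rw [A.T_T_eq, map_smul, LinearMap.smul_apply, smul_inv_smul₀ two_ne_zero]
  linear_combination (norm := module) -h

end VOACFT

/-- Lemma `V2`: in a VOA of CFT type, any conformal vector
`a ∈ V_2 ∩ CV` has the form `a = ω + Th` for some `h ∈ V_1`. -/
theorem conformal_in_V2_eq_omega_add_Th {K V : Type*} [RCLike K]
    [AddCommGroup V] [Module K V]
    (A : VA K V) (W : VOACFT A) (a : V)
    (ha : a ∈ W.gr 2) (hc : A.IsConformal a) :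
    ∃ h ∈ W.gr 1, a = W.ω + A.T h := by
  obtain ⟨-, -, -, -, h0, -⟩ := hc
  have hb : a - W.ω ∈ W.gr 2 := sub_mem ha W.ω_mem
  have hb0 : A.ncoef 0 (a - W.ω) = 0 := by rw [map_sub, h0, W.Lneg1_eq_T, sub_self]
  have hh : (2 : K)⁻¹ • A.ncoef 2 W.ω (a - W.ω) ∈ W.gr 1 :=
    Submodule.smul_mem _ _ (by simpa using W.ω_ncoef_mem hb 2)
  refine ⟨_, hh, ?_⟩
  have hzero := W.eq_zero_of_T_eq_zero (sub_mem hb (W.T_mem hh))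
    (by rw [map_sub, W.T_eq_T_T_of_ncoef_zero hb hb0, sub_self])
  rw [← sub_eq_zero.mp hzero, add_sub_cancel]
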